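/- arXiv:1911.01988 — 5 statements merged into one kernel-verified Lean document; each statement's English description precedes it below -/
import Mathlib

section
/- Let G be a finite simple graph with vertex set V, let F : ℕ → ℕ be a percolation function, let m ∈ ℕ satisfy m ≤ F(t) for all t, and suppose the set {t ∈ ℕ : F(t) = m} is infinite. Then for every initially infected set A₀ ⊆ V, the final infected set of the F(t)-bootstrap percolation process started from A₀ equals the final infected set of the m-bootstrap percolation process (i.e. the process with the constant percolation function equal to m) started from A₀. -/
/-- The `F(t)`-bootstrap percolation process on a finite simple graph `G`:
`perc G F A₀ t` is the set of infected vertices at time `t`, starting from the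
initially infected set `A₀`, where at each step every vertex with at least
`F t` infected neighbors becomes infected. -/
def perc {V : Type*} [Fintype V] [DecidableEq V] (G : SimpleGraph V) [DecidableRel G.Adj]
    (F : ℕ → ℕ) (A₀ : Finset V) : ℕ → Finset V
  | 0 => A₀
  | (t + 1) =>
      perc G F A₀ t ∪
        Finset.univ.filter (fun v => F t ≤ ((G.neighborFinset v) ∩ perc G F A₀ t).card)
theorem perc_mono_time {V : Type*} [Fintype V] [DecidableEq V]
    (G : SimpleGraph V) [DecidableRel G.Adj] (F : ℕ → ℕ) (A₀ : Finset V) :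
    Monotone (perc G F A₀) := by
  apply monotone_nat_of_le_succ
  intro t v hv
  rw [perc]
  exact Finset.mem_union_left _ hv

theorem perc_step_subset {V : Type*} [Fintype V] [DecidableEq V]
    (G : SimpleGraph V) [DecidableRel G.Adj] (F H : ℕ → ℕ) (A₀ : Finset V) (s t : ℕ)
    (h : perc G F A₀ s ⊆ perc G H A₀ t) (hFH : H t ≤ F s) :
    perc G F A₀ (s + 1) ⊆ perc G H A₀ (t + 1) := by
  intro v hv
  rw [perc, Finset.mem_union, Finset.mem_filter] at hv ⊢
  rcases hv with hv | ⟨_, hv⟩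
  · exact Or.inl (h hv)
  · exact Or.inr ⟨Finset.mem_univ _, hFH.trans (hv.trans
      (Finset.card_le_card (Finset.inter_subset_inter_left h)))⟩

theorem perc_final_eq_min_const {V : Type*} [Fintype V] [DecidableEq V]
    (G : SimpleGraph V) [DecidableRel G.Adj] (F : ℕ → ℕ) (m : ℕ)
    (hmin : ∀ t : ℕ, m ≤ F t) (hinf : {t : ℕ | F t = m}.Infinite) :
    ∀ A₀ : Finset V,
      {v : V | ∃ t : ℕ, v ∈ perc G F A₀ t} =
        {v : V | ∃ t : ℕ, v ∈ perc G (fun _ => m) A₀ t} := by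
  intro A₀
  have h1 : ∀ t, perc G F A₀ t ⊆ perc G (fun _ => m) A₀ t := by
    intro t
    induction t with
    | zero => simp [perc]
    | succ t ih => exact perc_step_subset G _ _ A₀ t t ih (hmin t)
  have h2 : ∀ t, ∃ s, perc G (fun _ => m) A₀ t ⊆ perc G F A₀ s := by
    intro t
    induction t with
    | zero => exact ⟨0, by simp [perc]⟩
    | succ t ih =>
      obtain ⟨s, hs⟩ := ih
      obtain ⟨u, hu, hsu⟩ := hinf.exists_gt s
      exact ⟨u + 1, perc_step_subset G _ _ A₀ t u
        (hs.trans (perc_mono_time G F A₀ hsu.le)) (le_of_eq hu)⟩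
  ext v
  constructor
  · rintro ⟨t, ht⟩
    exact ⟨t, h1 t ht⟩
  · rintro ⟨t, ht⟩
    obtain ⟨s, hs⟩ := h2 t
    exact ⟨s, hs ht⟩
end

section
/- Let G be a finite simple graph with ℓ vertices, let F : ℕ → ℕ be a percolation function, and let A₀ be an initially infected set. Let t ∈ ℕ and suppose there is a time t_p < t with F(t_p) < F(t) such that F(s) ≥ F(t) for every s with t_p < s < t, and suppose that the number of times s with t_p < s < t and F(s) = F(t) is strictly greater than ℓ. Then no vertex becomes infected at time t, i.e. A_{t+1} = A_t. -/
theorem perc_subset_succ {V : Type*} [Fintype V] [DecidableEq V]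
    (G : SimpleGraph V) [DecidableRel G.Adj] (F : ℕ → ℕ) (A₀ : Finset V) (s : ℕ) :
    perc G F A₀ s ⊆ perc G F A₀ (s + 1) := by
  rw [perc]
  exact Finset.subset_union_left

theorem perc_stable {V : Type*} [Fintype V] [DecidableEq V]
    (G : SimpleGraph V) [DecidableRel G.Adj] (F : ℕ → ℕ) (A₀ : Finset V) (s u : ℕ)
    (hs : perc G F A₀ (s + 1) = perc G F A₀ s) (hu : perc G F A₀ u = perc G F A₀ s)
    (hF : F s ≤ F u) : perc G F A₀ (u + 1) = perc G F A₀ s := by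
  apply Finset.Subset.antisymm
  · intro v hv
    rw [perc, hu, Finset.mem_union, Finset.mem_filter] at hv
    rcases hv with hv | hv
    · exact hv
    · rw [← hs, perc, Finset.mem_union, Finset.mem_filter]
      exact Or.inr ⟨hv.1, hF.trans hv.2⟩
  · rw [← hu]
    exact perc_subset_succ G F A₀ u

theorem no_infection_after_many_repeats {V : Type*} [Fintype V] [DecidableEq V]
    (G : SimpleGraph V) [DecidableRel G.Adj] (F : ℕ → ℕ) (A₀ : Finset V)
    (t tp : ℕ) (htp : tp < t) (hFtp : F tp < F t)
    (hmin : ∀ s : ℕ, tp < s → s < t → F t ≤ F s)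
    (hcount : Fintype.card V < ((Finset.Ioo tp t).filter (fun s => F s = F t)).card) :
    perc G F A₀ (t + 1) = perc G F A₀ t := by
  have hmono : Monotone (perc G F A₀) :=
    monotone_nat_of_le_succ (fun s => perc_subset_succ G F A₀ s)
  obtain ⟨s, hsmem, hs⟩ : ∃ s ∈ (Finset.Ioo tp t).filter (fun s => F s = F t),
      perc G F A₀ (s + 1) = perc G F A₀ s := by
    by_contra! hne
    have hlt : ∀ s ∈ (Finset.Ioo tp t).filter (fun s => F s = F t),
        (perc G F A₀ s).card < (perc G F A₀ (s + 1)).card := fun s hs =>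
      Finset.card_lt_card
        (Finset.ssubset_iff_subset_ne.2 ⟨perc_subset_succ G F A₀ s, (hne s hs).symm⟩)
    have hsm : StrictMonoOn (fun s => (perc G F A₀ s).card)
        (((Finset.Ioo tp t).filter (fun s => F s = F t) : Finset ℕ) : Set ℕ) := by
      intro a ha b _ hab
      exact (hlt a ha).trans_le (Finset.card_le_card (hmono hab))
    have hle := Finset.card_le_card_of_injOn (t := Finset.range (Fintype.card V))
      (fun s => (perc G F A₀ s).card)
      (fun s hs => by
        simpa using (hlt s hs).trans_le (Finset.card_le_univ _)) hsm.injOn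
    rw [Finset.card_range] at hle
    omega
  rw [Finset.mem_filter, Finset.mem_Ioo] at hsmem
  obtain ⟨⟨h1, h2⟩, h3⟩ := hsmem
  have key : ∀ u, s ≤ u → u ≤ t → perc G F A₀ u = perc G F A₀ s := by
    intro u hu
    induction u, hu using Nat.le_induction with
    | base => intro _; rfl
    | succ u hu ih =>
      intro hut
      exact perc_stable G F A₀ s u hs (ih (by omega))
        (h3.le.trans (hmin u (by omega) (by omega)))
  have ht := key t h2.le le_rfl
  rw [ht]
  exact perc_stable G F A₀ s t hs ht h3.le
end

section
/- Let G be a finite simple graph with vertex set V, let F : ℕ → ℕ be a percolation function, let A₀ ⊆ V, and let σ : ℕ → ℕ be strictly increasing with σ(0) = 0. Define F'(t) := F(σ(t)), and suppose that for every time t not in the range of σ, no vertex becomes infected at time t under the F(t)-bootstrap percolation process started from A₀ (i.e. A^F_{t+1} = A^F_t for all such t). Then for every n ∈ ℕ one has A^{F}_{σ(n)} = A^{F'}_n, and consequently the final infected sets coincide: A^F_∞ = A^{F'}_∞ (i.e. F and F' are equivalent for this initial set). -/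
theorem perc_equiv_of_no_infection_off_range {V : Type*} [Fintype V] [DecidableEq V]
    (G : SimpleGraph V) [DecidableRel G.Adj] (F : ℕ → ℕ) (A₀ : Finset V)
    (σ : ℕ → ℕ) (hσ : StrictMono σ) (hσ0 : σ 0 = 0)
    (hquiet : ∀ t : ℕ, t ∉ Set.range σ → perc G F A₀ (t + 1) = perc G F A₀ t) :
    (∀ n : ℕ, perc G F A₀ (σ n) = perc G (fun s => F (σ s)) A₀ n) ∧
      {v : V | ∃ t : ℕ, v ∈ perc G F A₀ t} =
        {v : V | ∃ t : ℕ, v ∈ perc G (fun s => F (σ s)) A₀ t} := by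
  have hmono : Monotone (perc G F A₀) :=
    monotone_nat_of_le_succ fun t => by
      rw [perc]
      exact Finset.subset_union_left
  have key : ∀ n k : ℕ, σ n + 1 + k ≤ σ (n + 1) →
      perc G F A₀ (σ n + 1 + k) = perc G F A₀ (σ n + 1) := by
    intro n k
    induction k with
    | zero => intro _; rfl
    | succ k ih =>
      intro h
      rw [← ih (by omega)]
      refine hquiet (σ n + 1 + k) ?_
      rintro ⟨m, hm⟩
      have h1 : n < m := hσ.lt_iff_lt.mp (by omega)
      have h2 : m < n + 1 := hσ.lt_iff_lt.mp (by omega)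
      omega
  have main : ∀ n : ℕ, perc G F A₀ (σ n) = perc G (fun s => F (σ s)) A₀ n := by
    intro n
    induction n with
    | zero => rw [hσ0, perc, perc]
    | succ n ih =>
      have hlt : σ n < σ (n + 1) := hσ (Nat.lt_succ_self n)
      have h := key n (σ (n + 1) - (σ n + 1)) (by omega)
      rw [show σ n + 1 + (σ (n + 1) - (σ n + 1)) = σ (n + 1) by omega] at h
      rw [h, perc, perc, ih]
  refine ⟨main, ?_⟩
  ext v
  constructor
  · rintro ⟨t, ht⟩
    refine ⟨t, ?_⟩
    rw [← main t]
    exact hmono (hσ.id_le t) ht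
  · rintro ⟨t, ht⟩
    exact ⟨σ t, by rw [main t]; exact ht⟩
end

section
/- Let G be a finite simple graph with vertex set V, let F : ℕ → ℕ be a percolation function, and let A₀ ⊆ V. Let v ∉ A₀ be a vertex all of whose neighbors lie in A₀ (N(v) ⊆ A₀), and suppose v does not belong to the final infected set A_∞(A₀). Then v is isolated with regards to A₀: for every vertex w ∈ V with w ≠ v, v does not belong to the final infected set A_∞(A₀ ∪ {w}) of the process started from A₀ ∪ {w}. -/
theorem isolated_of_all_neighbors_infected {V : Type*} [Fintype V] [DecidableEq V]
    (G : SimpleGraph V) [DecidableRel G.Adj] (F : ℕ → ℕ) (A₀ : Finset V)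
    (v : V) (hv : v ∉ A₀) (hnbr : G.neighborFinset v ⊆ A₀)
    (hnot : ¬ ∃ t : ℕ, v ∈ perc G F A₀ t) :
    ∀ w : V, w ≠ v → ¬ ∃ t : ℕ, v ∈ perc G F (insert w A₀) t := by
  rintro w hw ⟨t, ht⟩
  have hsub : ∀ t, A₀ ⊆ perc G F A₀ t := by
    intro t
    induction t with
    | zero => simp [perc]
    | succ n ih => exact ih.trans (by rw [perc]; exact Finset.subset_union_left)
  induction t with
  | zero =>
    simp only [perc, Finset.mem_insert] at ht
    rcases ht with h | h
    · exact hw h.symm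
    · exact hv h
  | succ n ih =>
    rw [perc, Finset.mem_union] at ht
    rcases ht with h | h
    · exact ih h
    · apply hnot
      refine ⟨n + 1, ?_⟩
      rw [perc, Finset.mem_union]
      right
      simp only [Finset.mem_filter, Finset.mem_univ, true_and] at h ⊢
      rw [Finset.inter_eq_left.mpr (hnbr.trans (hsub n))]
      exact h.trans (Finset.card_le_card Finset.inter_subset_left)
end

section
/- Let T be a finite tree (a finite connected acyclic simple graph) with vertex set V, let F : ℕ → ℕ be a percolation function, and let A₀ ⊆ V. Let v ∉ A₀ be a vertex and suppose that for every neighbor s of v, the vertex v does not belong to the final infected set A_∞(A₀ ∪ {s}). Then v is isolated with regards to A₀: for every vertex w ∈ V with w ≠ v, v does not belong to the final infected set A_∞(A₀ ∪ {w}). -/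
theorem branch_exists {V : Type*} (T : SimpleGraph V) (htree : T.IsTree) (v w : V) (hw : w ≠ v) :
    ∃ (s : V) (C : Set V), T.Adj v s ∧ w ∈ C ∧ v ∉ C ∧
      (∀ x y, x ∉ C → x ≠ v → T.Adj x y → y ∉ C) ∧ (∀ y, T.Adj v y → y ∈ C → y = s) := by
  classical
  obtain ⟨p, hp⟩ := (htree.connected.preconnected v w).exists_isPath
  cases p with
  | nil => exact absurd rfl hw
  | @cons _ s _ h p =>
    rw [SimpleGraph.Walk.cons_isPath_iff] at hp
    have hb : ¬ (T.deleteEdges {s(v, s)}).Reachable v s := by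
      have := SimpleGraph.isAcyclic_iff_forall_adj_isBridge.1 htree.isAcyclic h
      rw [SimpleGraph.isBridge_iff] at this
      simpa using this
    have hvC : ¬ (T.deleteEdges {s(v, s)}).Reachable s v := fun h => hb h.symm
    refine ⟨s, {x | (T.deleteEdges {s(v, s)}).Reachable s x}, h, ?_, hvC, ?_, ?_⟩
    · exact ⟨p.toDeleteEdge s(v, s)
        (fun he => hp.2 (SimpleGraph.Walk.fst_mem_support_of_mem_edges p he))⟩
    · intro x y hx hxv hxy hy
      apply hx
      refine SimpleGraph.Reachable.trans hy (SimpleGraph.Adj.reachable ?_)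
      rw [SimpleGraph.deleteEdges_adj]
      refine ⟨hxy.symm, ?_⟩
      intro he
      rcases Sym2.eq_iff.1 (Set.mem_singleton_iff.1 he) with ⟨_, h2⟩ | ⟨_, h2⟩
      · subst h2
        exact hx (SimpleGraph.Reachable.refl _)
      · exact hxv h2
    · intro y hy hyC
      by_contra hne
      apply hvC
      refine SimpleGraph.Reachable.trans hyC (SimpleGraph.Adj.reachable ?_)
      rw [SimpleGraph.deleteEdges_adj]
      refine ⟨hy.symm, ?_⟩
      intro he
      rcases Sym2.eq_iff.1 (Set.mem_singleton_iff.1 he) with ⟨h1, h2⟩ | ⟨h1, _⟩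
      · exact hy.ne h1.symm |>.elim
      · exact hne h1

theorem subset_perc {V : Type*} [Fintype V] [DecidableEq V] (G : SimpleGraph V)
    [DecidableRel G.Adj] (F : ℕ → ℕ) (A : Finset V) (t : ℕ) : A ⊆ perc G F A t := by
  induction t with
  | zero => exact Finset.Subset.refl _
  | succ t ih => exact ih.trans Finset.subset_union_left

theorem isolated_of_no_neighbor_helps {V : Type*} [Fintype V] [DecidableEq V]
    (T : SimpleGraph V) [DecidableRel T.Adj] (htree : T.IsTree)
    (F : ℕ → ℕ) (A₀ : Finset V) (v : V) (hv : v ∉ A₀)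
    (hnbr : ∀ s ∈ T.neighborFinset v, ¬ ∃ t : ℕ, v ∈ perc T F (insert s A₀) t) :
    ∀ w : V, w ≠ v → ¬ ∃ t : ℕ, v ∈ perc T F (insert w A₀) t := by
  intro w hw
  obtain ⟨s, C, hs, hwC, hvC, hout, hin⟩ := branch_exists T htree v w hw
  have hS := hnbr s (by simpa using hs)
  push Not at hS
  have key : ∀ t, v ∉ perc T F (insert w A₀) t ∧
      ∀ x, x ∉ C → x ∈ perc T F (insert w A₀) t → x ∈ perc T F (insert s A₀) t := by
    intro t
    induction t with
    | zero =>
      refine ⟨?_, ?_⟩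
      · simp [perc, hv, hw.symm]
      · intro x hx hxw
        simp only [perc, Finset.mem_insert] at hxw ⊢
        rcases hxw with rfl | h
        · exact absurd hwC hx
        · exact Or.inr h
    | succ t ih =>
      obtain ⟨ih1, ih2⟩ := ih
      have hv' : v ∉ perc T F (insert w A₀) (t + 1) := by
        intro hmem
        simp only [perc, Finset.mem_union, Finset.mem_filter, Finset.mem_univ, true_and] at hmem
        rcases hmem with h | h
        · exact ih1 h
        · apply hS (t + 1)
          simp only [perc, Finset.mem_union, Finset.mem_filter, Finset.mem_univ, true_and]
          refine Or.inr (h.trans (Finset.card_le_card ?_))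
          intro y hy
          simp only [Finset.mem_inter, SimpleGraph.mem_neighborFinset] at hy ⊢
          refine ⟨hy.1, ?_⟩
          by_cases hyC : y ∈ C
          · rw [hin y hy.1 hyC]
            exact subset_perc _ _ _ _ (Finset.mem_insert_self _ _)
          · exact ih2 y hyC hy.2
      refine ⟨hv', ?_⟩
      intro x hx hmem
      have hxv : x ≠ v := fun h => hv' (h ▸ hmem)
      simp only [perc, Finset.mem_union, Finset.mem_filter, Finset.mem_univ, true_and] at hmem ⊢
      rcases hmem with h | h
      · exact Or.inl (ih2 x hx h)
      · refine Or.inr (h.trans (Finset.card_le_card ?_))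
        intro y hy
        simp only [Finset.mem_inter, SimpleGraph.mem_neighborFinset] at hy ⊢
        exact ⟨hy.1, ih2 y (hout x y hx hxv hy.1) hy.2⟩
  rintro ⟨t, ht⟩
  exact (key t).1 ht
end
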